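/- For every nonzero integer n, ⌊1/(e^{√2/n} − 1)⌋ = ⌊n/√2 − 1/2⌋. -/

import Mathlib

theorem inv_sub_half_le_inv_exp_sub_one {x : ℝ} (hx : 0 < x) :
    x⁻¹ - 1 / 2 ≤ (Real.exp x - 1)⁻¹ := by
  have hy : 0 < Real.exp x - 1 := by linarith [Real.add_one_lt_exp hx.ne']
  have h := Real.le_log_one_add_of_nonneg hy.le
  rw [add_sub_cancel, Real.log_exp, div_le_iff₀ (by linarith)] at h
  generalize Real.exp x - 1 = y at *
  have h2 : y⁻¹ - (x⁻¹ - 1 / 2) = (x * (y + 2) - 2 * y) / (2 * x * y) := by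
    field_simp
    ring
  have h3 : 0 ≤ (x * (y + 2) - 2 * y) / (2 * x * y) :=
    div_nonneg (by linarith) (by positivity)
  linarith

theorem inv_exp_sub_one_le {x : ℝ} (hx : 0 < x) :
    (Real.exp x - 1)⁻¹ ≤ x⁻¹ - 1 / 2 + x / 12 := by
  have hy : 0 < Real.exp x - 1 := by linarith [Real.add_one_lt_exp hx.ne']
  have h := Real.sum_le_exp_of_nonneg hx.le 6
  simp only [Finset.sum_range_succ, Finset.sum_range_zero, Nat.factorial] at h
  norm_num at h
  have hq : 0 < 12 - 6 * x + x ^ 2 := by nlinarith [sq_nonneg (x - 3)]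
  have hp : 0 ≤ x ^ 5 * (2 - x + x ^ 2) :=
    mul_nonneg (by positivity) (by nlinarith [sq_nonneg (x - 1)])
  have h1 : 12 * x ≤ (12 - 6 * x + x ^ 2) * (Real.exp x - 1) := by
    nlinarith [mul_le_mul_of_nonneg_left h hq.le]
  have h2 : x⁻¹ - 1 / 2 + x / 12 = (12 - 6 * x + x ^ 2) / (12 * x) := by
    field_simp
    ring
  rw [h2, inv_le_comm₀ hy (by positivity), inv_div, div_le_iff₀ hq]
  linarith

/-- No integer lies within `√2 / (12 n)` above `n / √2 - 1 / 2`. -/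
theorem lt_of_div_sqrt_two_sub_half_le {n m : ℤ} (hn : 0 < n)
    (h : (n : ℝ) / Real.sqrt 2 - 1 / 2 ≤ m) :
    (n : ℝ) / Real.sqrt 2 - 1 / 2 + Real.sqrt 2 / n / 12 < m := by
  have hs : Real.sqrt 2 ^ 2 = 2 := Real.sq_sqrt (by norm_num)
  have hs0 : 0 < Real.sqrt 2 := by positivity
  generalize Real.sqrt 2 = s at *
  have hn1 : (1 : ℝ) ≤ n := by exact_mod_cast hn
  have hdiv : (n : ℝ) / s = n * s / 2 := by
    field_simp
    linarith
  rw [hdiv] at h ⊢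
  have hk : (n : ℝ) * s ≤ 2 * m + 1 := by linarith
  have hsq : 2 * (n : ℝ) ^ 2 ≤ (2 * m + 1) ^ 2 := by
    have := pow_le_pow_left₀ (by positivity) hk 2
    rwa [mul_pow, hs, mul_comm] at this
  have hint : 2 * n ^ 2 + 1 ≤ (2 * m + 1) ^ 2 := by
    have h1 : 2 * n ^ 2 ≤ (2 * m + 1) ^ 2 := by exact_mod_cast hsq
    have h2 : (2 * m + 1) ^ 2 = 2 * (2 * m ^ 2 + 2 * m) + 1 := by ring
    lia
  have hreal : 2 * (n : ℝ) ^ 2 + 1 ≤ (2 * m + 1) ^ 2 := by exact_mod_cast hint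
  by_contra! hc
  have hk2 : 2 * (m : ℝ) + 1 ≤ n * s + s / n / 6 := by linarith
  have hu := pow_le_pow_left₀ (by nlinarith) hk2 2
  have he : ((n : ℝ) * s + s / n / 6) ^ 2 = s ^ 2 * (n ^ 2 + 1 / 3 + 1 / n ^ 2 / 36) := by
    field_simp
    ring
  have hi : 1 / (n : ℝ) ^ 2 ≤ 1 := by
    rw [div_le_one (by positivity)]
    nlinarith
  rw [he, hs] at hu
  linarith

theorem inv_exp_neg_sub_one {x : ℝ} (hx : x ≠ 0) :
    (Real.exp (-x) - 1)⁻¹ = -1 - (Real.exp x - 1)⁻¹ := by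
  have h1 : Real.exp x - 1 ≠ 0 := by simpa [sub_eq_zero] using hx
  have h2 : 1 - Real.exp x ≠ 0 := by rwa [← neg_sub, neg_ne_zero]
  have h3 : (Real.exp x)⁻¹ - 1 = (1 - Real.exp x) / Real.exp x := by
    field_simp
  rw [Real.exp_neg, h3, inv_div]
  field_simp
  ring

theorem stmt16 (n : ℤ) (hn : n ≠ 0) :
    ⌊(Real.exp (Real.sqrt 2 / n) - 1)⁻¹⌋ = ⌊(n : ℝ) / Real.sqrt 2 - 1 / 2⌋ := by
  rcases hn.lt_or_gt with h | h
  · obtain ⟨k, rfl⟩ : ∃ k : ℤ, n = -k := ⟨-n, by ring⟩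
    have hk : 0 < k := by lia
    have hk' : (0 : ℝ) < k := by exact_mod_cast hk
    have hx : 0 < Real.sqrt 2 / (k : ℝ) := by positivity
    have hl := inv_sub_half_le_inv_exp_sub_one hx
    have hu := inv_exp_sub_one_le hx
    rw [inv_div] at hl hu
    rw [Int.cast_neg, div_neg, inv_exp_neg_sub_one hx.ne', neg_div]
    refine le_antisymm (Int.floor_le_floor (by linarith)) (Int.le_floor.2 ?_)
    have hf := Int.floor_le (-((k : ℝ) / Real.sqrt 2) - 1 / 2)
    generalize ⌊-((k : ℝ) / Real.sqrt 2) - 1 / 2⌋ = m at *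
    have hg := lt_of_div_sqrt_two_sub_half_le (m := -1 - m) hk (by push_cast; linarith)
    push_cast at hg
    linarith
  · have hn' : (0 : ℝ) < n := by exact_mod_cast h
    have hx : 0 < Real.sqrt 2 / (n : ℝ) := by positivity
    have hl := inv_sub_half_le_inv_exp_sub_one hx
    have hu := inv_exp_sub_one_le hx
    rw [inv_div] at hl hu
    refine le_antisymm (Int.le_floor.2 ?_) (Int.floor_le_floor hl)
    by_contra! hc
    have hg := lt_of_div_sqrt_two_sub_half_le h hc.le
    linarith [Int.floor_le (Real.exp (Real.sqrt 2 / n) - 1)⁻¹]
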